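/- (Rate of convergence in the SLLN for the RWI.) Almost surely, ‖S_n/n − μ‖² = O((log n)/n) as n → ∞; that is, almost surely there exist C>0 and N such that for all n ≥ N, ‖S_n/n − μ‖² ≤ C (log n)/n. -/

import Mathlib

open MeasureTheory ProbabilityTheory Real Filter Set
open scoped BigOperators NNReal

noncomputable section

namespace RWI

abbrev E : Type := EuclideanSpace ℝ (Fin 3)

def vec (x y z : ℝ) : E := (EuclideanSpace.equiv (Fin 3) ℝ).symm ![x, y, z]

/-- The two families of vertices of the `1h` ice lattice. -/
def V (a h : ℝ) (i : Fin 2) : Set E :=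
  {v | ∃ k l n : ℤ, v = vec (a * ((i : ℕ) + (3 / 2) * k))
      (a * ((Real.sqrt 3 / 2) * k + Real.sqrt 3 * l)) (h * n)}

/-- Horizontal jump from a vertex of type `i` in direction `j`. -/
def w (a : ℝ) (i : Fin 2) (j : Fin 3) : E :=
  vec (a * Real.cos (2 * (j : ℕ) * π / 3 + (i : ℕ) * π))
      (a * Real.sin (2 * (j : ℕ) * π / 3 + (i : ℕ) * π)) 0

/-- `S` is a random walk on ice with parameters `a, h, p, α, q` and natural filtration `F`. -/
structure IsRWI {Ω : Type} [MeasurableSpace Ω] (P : Measure Ω)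
    (a h p α : ℝ) (q : Fin 2 → Fin 3 → ℝ)
    (S : ℕ → Ω → E) (F : ℕ → MeasurableSpace Ω) : Prop where
  prob : IsProbabilityMeasure P
  ha : 0 < a
  hh : 0 < h
  hp0 : 0 ≤ p
  hp1 : p ≤ 1
  hα0 : 0 < α
  hα1 : α < 1
  hq : ∀ i j, 0 ≤ q i j
  hqsum : ∀ i, q i 0 + q i 1 + q i 2 = 1 - p
  hS0 : ∀ ω, S 0 ω = 0
  hSmeas : ∀ n, Measurable (S n)
  hF : ∀ n, F n =
    MeasurableSpace.comap (fun ω (k : Fin n) => S ((k : ℕ) + 1) ω - S (k : ℕ) ω)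
      MeasurableSpace.pi
  hTrans : ∀ (n : ℕ) (f : E → ℝ), Measurable f → (∃ C, ∀ x, |f x| ≤ C) →
    P[fun ω => f (S (n + 1) ω)|F n] =ᵐ[P]
      fun ω => ∑ i : Fin 2, (V a h i).indicator (fun _ => (1 : ℝ)) (S n ω) *
        (α * p * f (S n ω + vec 0 0 h) + (1 - α) * p * f (S n ω + vec 0 0 (-h)) +
          ∑ j : Fin 3, q i j * f (S n ω + w a i j))

def uu (q : Fin 2 → Fin 3 → ℝ) (i : Fin 2) : ℝ := q i 1 + q i 2

def vv (q : Fin 2 → Fin 3 → ℝ) (i : Fin 2) : ℝ := q i 1 - q i 2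

/-- The drift vector `μ` of the RWI. -/
def muI (a h p α : ℝ) (q : Fin 2 → Fin 3 → ℝ) : E :=
  vec (3 * a / 4 * (-(uu q 0) + uu q 1)) (a * Real.sqrt 3 / 4 * (vv q 0 - vv q 1))
    (h * p * (2 * α - 1))

/-- The vector `θ` of the RWI. -/
def thetaI (a p : ℝ) (q : Fin 2 → Fin 3 → ℝ) : E :=
  vec (a * ((1 - p) - 3 / 4 * (uu q 0 + uu q 1))) (a * Real.sqrt 3 / 4 * (vv q 0 + vv q 1)) 0

/-- The sign process `ε_n = 1_{S_n ∈ V_0} - 1_{S_n ∈ V_1}`. -/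
def epsI {Ω : Type} (a h : ℝ) (S : ℕ → Ω → E) (n : ℕ) (ω : Ω) : ℝ :=
  (V a h 0).indicator (fun _ => (1 : ℝ)) (S n ω) - (V a h 1).indicator (fun _ => (1 : ℝ)) (S n ω)

end RWI

namespace RWI

/-- A centred finite distribution supported in `[-c, c]` is sub-Gaussian with variance proxy `c ^ 2`. -/
lemma sum_mul_exp_le {ι : Type*} [Fintype ι] (r d : ι → ℝ) {c : ℝ} (hc : 0 < c)
    (hr : ∀ s, 0 ≤ r s) (hr1 : ∑ s, r s = 1) (hd : ∀ s, |d s| ≤ c) (hrd : ∑ s, r s * d s = 0)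
    (t : ℝ) : ∑ s, r s * rexp (t * d s) ≤ rexp (t ^ 2 * c ^ 2 / 2) := by
  have key : ∀ s, rexp (t * d s) ≤ Real.cosh (t * c) + d s * (Real.sinh (t * c) / c) := by
    intro s
    obtain ⟨h1, h2⟩ := abs_le.mp (hd s)
    have hconv := convexOn_exp.2 (mem_univ (t * c)) (mem_univ (-(t * c)))
      (show 0 ≤ (c + d s) / (2 * c) by apply div_nonneg <;> linarith)
      (show 0 ≤ (c - d s) / (2 * c) by apply div_nonneg <;> linarith)
      (by field_simp; ring)
    have e1 : ((c + d s) / (2 * c)) • (t * c) + ((c - d s) / (2 * c)) • (-(t * c)) = t * d s := by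
      simp only [smul_eq_mul]; field_simp; ring
    rw [e1] at hconv
    refine hconv.trans (le_of_eq ?_)
    rw [Real.cosh_eq, Real.sinh_eq]
    simp only [smul_eq_mul]; field_simp; ring
  calc ∑ s, r s * rexp (t * d s)
      ≤ ∑ s, r s * (Real.cosh (t * c) + d s * (Real.sinh (t * c) / c)) :=
        Finset.sum_le_sum fun s _ => mul_le_mul_of_nonneg_left (key s) (hr s)
    _ = (∑ s, r s) * Real.cosh (t * c) + (∑ s, r s * d s) * (Real.sinh (t * c) / c) := by
        rw [Finset.sum_mul, Finset.sum_mul, ← Finset.sum_add_distrib]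
        exact Finset.sum_congr rfl fun s _ => by ring
    _ = Real.cosh (t * c) := by rw [hr1, hrd]; ring
    _ ≤ rexp (t ^ 2 * c ^ 2 / 2) := by
        rw [← mul_pow]; exact Real.cosh_le_exp_half_sq _

@[simp] lemma vec_zero (x y z : ℝ) : vec x y z 0 = x := rfl

@[simp] lemma vec_one (x y z : ℝ) : vec x y z 1 = y := rfl

@[simp] lemma vec_two (x y z : ℝ) : vec x y z 2 = z := rfl

lemma vec_add_vec (x y z x' y' z' : ℝ) :
    vec x y z + vec x' y' z' = vec (x + x') (y + y') (z + z') := by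
  ext k; fin_cases k <;> rfl

lemma zero_eq_vec : (0 : E) = vec 0 0 0 := by
  ext k; fin_cases k <;> rfl

/-- The five possible jumps from a vertex of type `i`. -/
def step (a h : ℝ) (i : Fin 2) : Fin 5 → E :=
  ![vec 0 0 h, vec 0 0 (-h), w a i 0, w a i 1, w a i 2]

/-- The probabilities of the five jumps from a vertex of type `i`. -/
def weight (p α : ℝ) (q : Fin 2 → Fin 3 → ℝ) (i : Fin 2) : Fin 5 → ℝ :=
  ![α * p, (1 - α) * p, q i 0, q i 1, q i 2]

/-- The transition operator of the walk. -/
def transition (a h p α : ℝ) (q : Fin 2 → Fin 3 → ℝ) (f : E → ℝ) (x : E) : ℝ :=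
  ∑ i : Fin 2, (V a h i).indicator (fun _ => (1 : ℝ)) x *
    ∑ s, weight p α q i s * f (x + step a h i s)

lemma cos_four_pi_div_three : Real.cos (4 * π / 3) = -(1 / 2) := by
  rw [show 4 * π / 3 = π / 3 + π by ring, Real.cos_add_pi, Real.cos_pi_div_three]

lemma sin_four_pi_div_three : Real.sin (4 * π / 3) = -(√3 / 2) := by
  rw [show 4 * π / 3 = π / 3 + π by ring, Real.sin_add_pi, Real.sin_pi_div_three]

lemma cos_two_pi_div_three : Real.cos (2 * π / 3) = -(1 / 2) := by
  rw [show 2 * π / 3 = π - π / 3 by ring, Real.cos_pi_sub, Real.cos_pi_div_three]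

lemma sin_two_pi_div_three : Real.sin (2 * π / 3) = √3 / 2 := by
  rw [show 2 * π / 3 = π - π / 3 by ring, Real.sin_pi_sub, Real.sin_pi_div_three]

lemma w_zero_right (a : ℝ) (i : Fin 2) : w a i 0 = vec ((-1) ^ (i : ℕ) * a) 0 0 := by
  fin_cases i <;> simp [w]

lemma w_one_right (a : ℝ) (i : Fin 2) :
    w a i 1 = vec ((-1) ^ (i : ℕ) * (-(a / 2))) ((-1) ^ (i : ℕ) * (a * √3 / 2)) 0 := by
  fin_cases i <;>
    simp [w, Real.cos_add_pi, Real.sin_add_pi, cos_two_pi_div_three, sin_two_pi_div_three] <;>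
    congr 1 <;> ring

lemma w_two_right (a : ℝ) (i : Fin 2) :
    w a i 2 = vec ((-1) ^ (i : ℕ) * (-(a / 2))) ((-1) ^ (i : ℕ) * (-(a * √3 / 2))) 0 := by
  have e : 2 * 2 * π / 3 = 4 * π / 3 := by ring
  fin_cases i <;>
    simp [w, e, Real.cos_add_pi, Real.sin_add_pi, cos_four_pi_div_three, sin_four_pi_div_three] <;>
    congr 1 <;> ring

lemma measurableSet_V (a h : ℝ) (i : Fin 2) : MeasurableSet (V a h i) := by
  apply Set.Countable.measurableSet
  refine (Set.countable_range (fun k : ℤ × ℤ × ℤ =>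
    vec (a * ((i : ℕ) + (3 / 2) * k.1))
      (a * ((Real.sqrt 3 / 2) * k.1 + Real.sqrt 3 * k.2.1)) (h * k.2.2))).mono ?_
  rintro v ⟨k, l, n, rfl⟩
  exact ⟨(k, l, n), rfl⟩

lemma notMem_V_one {a h : ℝ} (ha : 0 < a) {x : E} (hx : x ∈ V a h 0) : x ∉ V a h 1 := by
  obtain ⟨k, l, n, rfl⟩ := hx
  rintro ⟨k', l', n', hv⟩
  have h0 := congrArg (fun v : E => v 0) hv
  simp only [vec_zero] at h0
  have h1 := mul_left_cancel₀ ha.ne' h0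
  have h2 : (3 * k : ℝ) = 2 + 3 * k' := by norm_num at h1; linarith
  have h3 : 3 * k = 2 + 3 * k' := by exact_mod_cast h2
  omega

lemma zero_mem_V (a h : ℝ) : (0 : E) ∈ V a h 0 :=
  ⟨0, 0, 0, by simp [zero_eq_vec]⟩

lemma add_vertical_mem_V {a h : ℝ} {i : Fin 2} {x : E} (hx : x ∈ V a h i) (m : ℤ) :
    x + vec 0 0 (h * m) ∈ V a h i := by
  obtain ⟨k, l, n, rfl⟩ := hx
  refine ⟨k, l, n + m, ?_⟩
  rw [vec_add_vec]
  push_cast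
  congr 1 <;> ring

lemma add_w_mem_V_one {a h : ℝ} {x : E} (hx : x ∈ V a h 0) (j : Fin 3) :
    x + w a 0 j ∈ V a h 1 := by
  obtain ⟨k, l, n, rfl⟩ := hx
  fin_cases j
  · refine ⟨k, l, n, ?_⟩
    simp only [Fin.zero_eta, w_zero_right, vec_add_vec]
    congr 1 <;> simp; ring
  · refine ⟨k - 1, l + 1, n, ?_⟩
    simp only [Fin.mk_one, w_one_right, vec_add_vec]
    congr 1 <;> simp <;> ring
  · refine ⟨k - 1, l, n, ?_⟩
    simp only [Fin.reduceFinMk, w_two_right, vec_add_vec]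
    congr 1 <;> simp <;> ring

lemma add_w_mem_V_zero {a h : ℝ} {x : E} (hx : x ∈ V a h 1) (j : Fin 3) :
    x + w a 1 j ∈ V a h 0 := by
  obtain ⟨k, l, n, rfl⟩ := hx
  fin_cases j
  · refine ⟨k, l, n, ?_⟩
    simp only [Fin.zero_eta, w_zero_right, vec_add_vec]
    congr 1 <;> simp; ring
  · refine ⟨k + 1, l - 1, n, ?_⟩
    simp only [Fin.mk_one, w_one_right, vec_add_vec]
    congr 1 <;> simp <;> ring
  · refine ⟨k + 1, l, n, ?_⟩
    simp only [Fin.reduceFinMk, w_two_right, vec_add_vec]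
    congr 1 <;> simp <;> ring

/-- The sign of a vertex: `1` on `V_0` and `-1` on `V_1`. -/
def sign (a h : ℝ) (x : E) : ℝ :=
  (V a h 0).indicator (fun _ => (1 : ℝ)) x - (V a h 1).indicator (fun _ => (1 : ℝ)) x

lemma measurable_sign (a h : ℝ) : Measurable (sign a h) :=
  (measurable_const.indicator (measurableSet_V a h 0)).sub
    (measurable_const.indicator (measurableSet_V a h 1))

lemma sign_of_mem {a h : ℝ} (ha : 0 < a) {i : Fin 2} {x : E} (hx : x ∈ V a h i) :
    sign a h x = (-1) ^ (i : ℕ) := by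
  fin_cases i
  · simp only [Fin.zero_eta] at hx
    simp [sign, hx, notMem_V_one ha hx]
  · simp only [Fin.mk_one] at hx
    have : x ∉ V a h 0 := fun h0 => notMem_V_one ha h0 hx
    simp [sign, hx, this]

lemma abs_sign_le (a h : ℝ) (x : E) : |sign a h x| ≤ 1 := by
  unfold sign Set.indicator
  split_ifs <;> norm_num

lemma sign_add_step {a h : ℝ} (ha : 0 < a) {i : Fin 2} {x : E} (hx : x ∈ V a h i) (s : Fin 5) :
    sign a h (x + step a h i s) = (-1) ^ (i : ℕ) * ![1, 1, -1, -1, -1] s := by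
  have hv : ∀ m : ℤ, sign a h (x + vec 0 0 (h * m)) = (-1) ^ (i : ℕ) := fun m =>
    sign_of_mem ha (add_vertical_mem_V hx m)
  have hw : ∀ j, sign a h (x + w a i j) = -(-1) ^ (i : ℕ) := by
    intro j
    fin_cases i
    · simpa using sign_of_mem ha (add_w_mem_V_one hx j)
    · simpa using sign_of_mem ha (add_w_mem_V_zero hx j)
  have h1 := hv 1
  have h2 := hv (-1)
  simp only [Int.cast_one, mul_one, Int.cast_neg, mul_neg] at h1 h2
  fin_cases s <;> simp [step, h1, h2, hw]

/-- The conditional mean displacement at a vertex of type `i` is `μ + (-1) ^ i • θ`. -/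
lemma sum_weight_mul_step {a h p α : ℝ} {q : Fin 2 → Fin 3 → ℝ}
    (hq : ∀ i, q i 0 + q i 1 + q i 2 = 1 - p) (i : Fin 2) (k : Fin 3) :
    ∑ s, weight p α q i s * step a h i s k
      = muI a h p α q k + (-1) ^ (i : ℕ) * thetaI a p q k := by
  have h0 : q i 0 = 1 - p - q i 1 - q i 2 := by linarith [hq i]
  fin_cases i <;> fin_cases k <;>
    simp [Fin.sum_univ_five, weight, step, w_zero_right, w_one_right, w_two_right, muI, thetaI,
      uu, vv] at h0 ⊢ <;> (try rw [h0]) <;> ring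

lemma weight_nonneg {p α : ℝ} {q : Fin 2 → Fin 3 → ℝ} (hp : 0 ≤ p) (hα0 : 0 ≤ α) (hα1 : α ≤ 1)
    (hq : ∀ i j, 0 ≤ q i j) (i : Fin 2) (s : Fin 5) : 0 ≤ weight p α q i s := by
  have : 0 ≤ 1 - α := by linarith
  fin_cases s <;> simp [weight, hq] <;> positivity

lemma sum_weight {p α : ℝ} {q : Fin 2 → Fin 3 → ℝ}
    (hq : ∀ i, q i 0 + q i 1 + q i 2 = 1 - p) (i : Fin 2) : ∑ s, weight p α q i s = 1 := by
  simp [Fin.sum_univ_five, weight]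
  linarith [hq i]

/-- The coefficient of the sign in the martingale correction. -/
def corr (a p : ℝ) (q : Fin 2 → Fin 3 → ℝ) (k : Fin 3) : ℝ := thetaI a p q k / (2 * (1 - p))

lemma corr_mul {a p : ℝ} {q : Fin 2 → Fin 3 → ℝ} (hq0 : ∀ i j, 0 ≤ q i j)
    (hq : ∀ i, q i 0 + q i 1 + q i 2 = 1 - p) (k : Fin 3) :
    corr a p q k * (2 * (1 - p)) = thetaI a p q k := by
  rcases eq_or_ne p 1 with rfl | hp
  · have h1 : ∀ i, q i 1 = 0 := fun i => by linarith [hq i, hq0 i 0, hq0 i 1, hq0 i 2]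
    have h2 : ∀ i, q i 2 = 0 := fun i => by linarith [hq i, hq0 i 0, hq0 i 1, hq0 i 2]
    fin_cases k <;> simp [thetaI, uu, vv, h1, h2]
  · have : 1 - p ≠ 0 := sub_ne_zero.mpr hp.symm
    unfold corr
    field_simp

/-- The centred increment of the corrected `k`-th coordinate along jump `s` from type `i`. -/
def centred (a h p α : ℝ) (q : Fin 2 → Fin 3 → ℝ) (k : Fin 3) (i : Fin 2) (s : Fin 5) : ℝ :=
  step a h i s k + corr a p q k * ((-1) ^ (i : ℕ) * ![0, 0, -2, -2, -2] s) - muI a h p α q k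

lemma sum_weight_mul_centred {a h p α : ℝ} {q : Fin 2 → Fin 3 → ℝ} (hq0 : ∀ i j, 0 ≤ q i j)
    (hq : ∀ i, q i 0 + q i 1 + q i 2 = 1 - p) (k : Fin 3) (i : Fin 2) :
    ∑ s, weight p α q i s * centred a h p α q k i s = 0 := by
  have h1 := sum_weight_mul_step (a := a) (h := h) (α := α) hq i k
  have h2 := sum_weight (α := α) hq i
  have h3 : ∑ s, weight p α q i s * ![0, 0, -2, -2, -2] s = -(2 * (1 - p)) := by
    simp [Fin.sum_univ_five, weight]
    linarith [hq i]
  calc ∑ s, weight p α q i s * centred a h p α q k i s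
      = ∑ s, weight p α q i s * step a h i s k
        + corr a p q k * (-1) ^ (i : ℕ) * ∑ s, weight p α q i s * ![0, 0, -2, -2, -2] s
        - (∑ s, weight p α q i s) * muI a h p α q k := by
        rw [Finset.mul_sum, Finset.sum_mul, ← Finset.sum_add_distrib, ← Finset.sum_sub_distrib]
        exact Finset.sum_congr rfl fun s _ => by unfold centred; ring
    _ = 0 := by
        rw [h1, h2, h3, ← corr_mul hq0 hq k]; ring

/-- The corrected `k`-th coordinate, whose mean increment is constant. -/
def corrected (a h p : ℝ) (q : Fin 2 → Fin 3 → ℝ) (k : Fin 3) (x : E) : ℝ :=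
  x k + corr a p q k * (sign a h x - 1)

lemma measurable_corrected (a h p : ℝ) (q : Fin 2 → Fin 3 → ℝ) (k : Fin 3) :
    Measurable (corrected a h p q k) := by
  have h1 := measurable_sign a h
  have h2 : Measurable fun x : E => x k := by fun_prop
  unfold corrected
  fun_prop

lemma corrected_add_step {a h p α : ℝ} {q : Fin 2 → Fin 3 → ℝ} (ha : 0 < a) (k : Fin 3)
    {i : Fin 2} {x : E} (hx : x ∈ V a h i) (s : Fin 5) :
    corrected a h p q k (x + step a h i s)
      = corrected a h p q k x + muI a h p α q k + centred a h p α q k i s := by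
  have e : (![1, 1, -1, -1, -1] s : ℝ) = 1 + ![0, 0, -2, -2, -2] s := by
    fin_cases s <;> norm_num
  simp only [corrected, centred, sign_add_step ha hx, sign_of_mem ha hx, PiLp.add_apply, e]
  ring

lemma corrected_zero {a : ℝ} (ha : 0 < a) (h p : ℝ) (q : Fin 2 → Fin 3 → ℝ) (k : Fin 3) :
    corrected a h p q k 0 = 0 := by
  simp [corrected, sign_of_mem ha (zero_mem_V a h)]

lemma transition_of_mem {a h p α : ℝ} {q : Fin 2 → Fin 3 → ℝ} (ha : 0 < a) (f : E → ℝ)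
    {i : Fin 2} {x : E} (hx : x ∈ V a h i) :
    transition a h p α q f x = ∑ s, weight p α q i s * f (x + step a h i s) := by
  fin_cases i
  · simp only [Fin.zero_eta] at hx
    simp [transition, hx, notMem_V_one ha hx]
  · simp only [Fin.mk_one] at hx
    have : x ∉ V a h 0 := fun h0 => notMem_V_one ha h0 hx
    simp [transition, hx, this]

lemma transition_of_notMem {a h p α : ℝ} {q : Fin 2 → Fin 3 → ℝ} (f : E → ℝ) {x : E}
    (hx : ∀ i, x ∉ V a h i) : transition a h p α q f x = 0 := by
  simp [transition, hx]

section

variable {Ω : Type} [MeasurableSpace Ω] {P : Measure Ω} {a h p α : ℝ} {q : Fin 2 → Fin 3 → ℝ}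
  {S : ℕ → Ω → E} {F : ℕ → MeasurableSpace Ω}

lemma transition_mono (hRW : IsRWI P a h p α q S F) {f g : E → ℝ} (hfg : ∀ x, f x ≤ g x) (x : E) :
    transition a h p α q f x ≤ transition a h p α q g x := by
  refine Finset.sum_le_sum fun i _ => mul_le_mul_of_nonneg_left ?_
    (indicator_nonneg (fun _ _ => zero_le_one) _)
  exact Finset.sum_le_sum fun s _ => mul_le_mul_of_nonneg_left (hfg _)
    (weight_nonneg hRW.hp0 hRW.hα0.le hRW.hα1.le hRW.hq i s)

lemma lintegral_succ_of_bounded (hRW : IsRWI P a h p α q S F) (n : ℕ) {f : E → ℝ}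
    (hf : Measurable f) (hf0 : ∀ x, 0 ≤ f x) {C : ℝ} (hC : ∀ x, f x ≤ C) :
    ∫⁻ ω, ENNReal.ofReal (f (S (n + 1) ω)) ∂P
      = ∫⁻ ω, ENNReal.ofReal (transition a h p α q f (S n ω)) ∂P := by
  have := hRW.prob
  have hb : ∀ x, |f x| ≤ C := fun x => by rw [abs_of_nonneg (hf0 x)]; exact hC x
  have hm : F n ≤ ‹MeasurableSpace Ω› := by
    rw [hRW.hF n, ← measurable_iff_comap_le]
    have := hRW.hSmeas
    fun_prop
  have hT : P[fun ω => f (S (n + 1) ω)|F n] =ᵐ[P] fun ω => transition a h p α q f (S n ω) := by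
    refine (hRW.hTrans n f hf ⟨C, hb⟩).trans (Eventually.of_forall fun ω => ?_)
    refine Finset.sum_congr rfl fun i _ => ?_
    simp [Fin.sum_univ_five, Fin.sum_univ_three, weight, step]
    ring_nf
    simp
  have hT0 : ∀ x, 0 ≤ transition a h p α q f x := fun x => by
    have := transition_mono hRW (f := fun _ => 0) hf0 x
    simpa [transition] using this
  have hint : Integrable (fun ω => f (S (n + 1) ω)) P :=
    Integrable.of_bound (hf.comp (hRW.hSmeas _)).aestronglyMeasurable C
      (Eventually.of_forall fun ω => hb _)
  rw [← ofReal_integral_eq_lintegral_ofReal hint (Eventually.of_forall fun ω => hf0 _),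
    ← ofReal_integral_eq_lintegral_ofReal (integrable_condExp.congr hT)
      (Eventually.of_forall fun ω => hT0 _),
    ← integral_congr_ae hT, integral_condExp hm]

lemma lintegral_succ_le (hRW : IsRWI P a h p α q S F) (n : ℕ) {f g : E → ℝ}
    (hf : Measurable f) (hf0 : ∀ x, 0 ≤ f x) (hfg : ∀ x, transition a h p α q f x ≤ g x) :
    ∫⁻ ω, ENNReal.ofReal (f (S (n + 1) ω)) ∂P ≤ ∫⁻ ω, ENNReal.ofReal (g (S n ω)) ∂P := by
  have hsup : ∀ x, ENNReal.ofReal (f x) = ⨆ R : ℕ, ENNReal.ofReal (min (f x) R) := by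
    intro x
    apply le_antisymm
    · obtain ⟨R, hR⟩ := exists_nat_ge (f x)
      exact le_iSup_of_le R (by rw [min_eq_left hR])
    · exact iSup_le fun R => ENNReal.ofReal_le_ofReal (min_le_left _ _)
  have hmeas := hRW.hSmeas (n + 1)
  simp_rw [hsup]
  rw [lintegral_iSup (f := fun (R : ℕ) ω => ENNReal.ofReal (min (f (S (n + 1) ω)) R))
    (fun R => by fun_prop) (fun R R' hRR' ω => ENNReal.ofReal_le_ofReal
      (min_le_min_left _ (by exact_mod_cast hRR')))]
  refine iSup_le fun R => ?_
  rw [lintegral_succ_of_bounded hRW n (f := fun x => min (f x) R) (by fun_prop)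
    (fun x => le_min (hf0 x) R.cast_nonneg) (fun x => min_le_right _ _)]
  exact lintegral_mono fun ω => ENNReal.ofReal_le_ofReal
    ((transition_mono hRW (fun x => min_le_left _ _) _).trans (hfg _))

/-- Exponential moment bound for an observable `G` with drift `m` and centred bounded increments. -/
lemma lintegral_exp_le (hRW : IsRWI P a h p α q S F) {G : E → ℝ} (hG : Measurable G)
    (hG0 : G 0 = 0) {m c : ℝ} (hc : 0 < c) {d : Fin 2 → Fin 5 → ℝ} (hd : ∀ i s, |d i s| ≤ c)
    (hd0 : ∀ i, ∑ s, weight p α q i s * d i s = 0)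
    (hstep : ∀ i, ∀ x ∈ V a h i, ∀ s, G (x + step a h i s) = G x + m + d i s) (t : ℝ) (n : ℕ) :
    ∫⁻ ω, ENNReal.ofReal (rexp (t * (G (S n ω) - n * m))) ∂P
      ≤ ENNReal.ofReal (rexp (n * (t ^ 2 * c ^ 2 / 2))) := by
  have := hRW.prob
  induction n with
  | zero => simp [hRW.hS0, hG0]
  | succ n ih =>
    have hbound : ∀ x, transition a h p α q (fun y => rexp (t * (G y - (n + 1 : ℕ) * m))) x
        ≤ rexp (t ^ 2 * c ^ 2 / 2) * rexp (t * (G x - n * m)) := by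
      intro x
      by_cases hx : ∃ i, x ∈ V a h i
      · obtain ⟨i, hx⟩ := hx
        rw [transition_of_mem hRW.ha _ hx]
        calc ∑ s, weight p α q i s * rexp (t * (G (x + step a h i s) - (n + 1 : ℕ) * m))
            = (∑ s, weight p α q i s * rexp (t * d i s)) * rexp (t * (G x - n * m)) := by
              rw [Finset.sum_mul]
              refine Finset.sum_congr rfl fun s _ => ?_
              rw [hstep i x hx s, mul_assoc, ← Real.exp_add]
              push_cast
              ring_nf
          _ ≤ _ := mul_le_mul_of_nonneg_right
              (sum_mul_exp_le _ _ hc (weight_nonneg hRW.hp0 hRW.hα0.le hRW.hα1.le hRW.hq i)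
                (sum_weight hRW.hqsum i) (hd i) (hd0 i) t) (Real.exp_pos _).le
      · rw [transition_of_notMem _ (not_exists.mp hx)]
        positivity
    refine (lintegral_succ_le hRW n (f := fun y => rexp (t * (G y - (n + 1 : ℕ) * m)))
      (by fun_prop) (fun x => (Real.exp_pos _).le) hbound).trans ?_
    simp_rw [ENNReal.ofReal_mul (Real.exp_pos (t ^ 2 * c ^ 2 / 2)).le]
    rw [lintegral_const_mul' _ _ ENNReal.ofReal_ne_top]
    refine (mul_le_mul_right ih _).trans (le_of_eq ?_)
    rw [← ENNReal.ofReal_mul (Real.exp_pos _).le, ← Real.exp_add]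
    push_cast
    ring_nf

lemma measure_ge_le (hRW : IsRWI P a h p α q S F) {G : E → ℝ} (hG : Measurable G)
    (hG0 : G 0 = 0) {m c : ℝ} (hc : 0 < c) {d : Fin 2 → Fin 5 → ℝ} (hd : ∀ i s, |d i s| ≤ c)
    (hd0 : ∀ i, ∑ s, weight p α q i s * d i s = 0)
    (hstep : ∀ i, ∀ x ∈ V a h i, ∀ s, G (x + step a h i s) = G x + m + d i s)
    {n : ℕ} (hn : 1 ≤ n) :
    P {ω | 2 * c * √(n * Real.log n) ≤ G (S n ω) - n * m}
      ≤ ENNReal.ofReal (1 / (n : ℝ) ^ 2) := by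
  have hn0 : (0 : ℝ) < n := by exact_mod_cast hn
  have hlog : 0 ≤ Real.log n := Real.log_natCast_nonneg n
  set L := √(n * Real.log n) with hL
  have hL2 : L ^ 2 = n * Real.log n := Real.sq_sqrt (by positivity)
  have hL0 : 0 ≤ L := Real.sqrt_nonneg _
  set t := 2 * L / (n * c) with ht
  have ht0 : 0 ≤ t := by positivity
  have hmeas : Measurable fun ω => ENNReal.ofReal (rexp (t * (G (S n ω) - n * m))) := by
    have := hRW.hSmeas n
    fun_prop
  have hmarkov := meas_ge_le_lintegral_div (μ := P) hmeas.aemeasurable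
    (ε := ENNReal.ofReal (rexp (t * (2 * c * L)))) (by simp [Real.exp_pos]) ENNReal.ofReal_ne_top
  refine (measure_mono fun ω hω => ?_).trans (hmarkov.trans ?_)
  · exact ENNReal.ofReal_le_ofReal (Real.exp_le_exp.mpr (mul_le_mul_of_nonneg_left hω ht0))
  · refine (ENNReal.div_le_div_right
      (lintegral_exp_le hRW hG hG0 hc hd hd0 hstep t n) _).trans (le_of_eq ?_)
    rw [← ENNReal.ofReal_div_of_pos (Real.exp_pos _), ← Real.exp_sub]
    congr 1
    have e : n * (t ^ 2 * c ^ 2 / 2) - t * (2 * c * L) = -(2 * Real.log n) := by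
      have : n * (t ^ 2 * c ^ 2 / 2) - t * (2 * c * L) = -2 * L ^ 2 / n := by
        rw [ht]; field_simp; ring
      rw [this, hL2]; field_simp
    rw [e, Real.exp_neg, ← Nat.cast_two (R := ℝ), Real.exp_nat_mul, Real.exp_log hn0]
    simp

lemma ae_eventually_lt (hRW : IsRWI P a h p α q S F) {G : E → ℝ} (hG : Measurable G)
    (hG0 : G 0 = 0) {m c : ℝ} (hc : 0 < c) {d : Fin 2 → Fin 5 → ℝ} (hd : ∀ i s, |d i s| ≤ c)
    (hd0 : ∀ i, ∑ s, weight p α q i s * d i s = 0)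
    (hstep : ∀ i, ∀ x ∈ V a h i, ∀ s, G (x + step a h i s) = G x + m + d i s) :
    ∀ᵐ ω ∂P, ∀ᶠ n : ℕ in atTop, G (S n ω) - n * m < 2 * c * √(n * Real.log n) := by
  have := hRW.prob
  have hsum : Summable fun n : ℕ => 1 / (n : ℝ) ^ 2 :=
    Real.summable_one_div_nat_pow.mpr one_lt_two
  have hfin : ∑' n : ℕ, P {ω | 2 * c * √((n + 1 : ℕ) * Real.log (n + 1 : ℕ))
      ≤ G (S (n + 1) ω) - (n + 1 : ℕ) * m} ≠ ⊤ := by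
    refine ne_top_of_le_ne_top ((summable_nat_add_iff 1).mpr hsum).tsum_ofReal_ne_top
      (ENNReal.tsum_le_tsum fun n => ?_)
    exact measure_ge_le hRW hG hG0 hc hd hd0 hstep (Nat.le_add_left 1 n)
  filter_upwards [ae_eventually_notMem hfin] with ω hω
  have := (tendsto_sub_atTop_nat 1).eventually hω
  filter_upwards [this, eventually_ge_atTop 1] with n hn hn1
  rw [Nat.sub_add_cancel hn1] at hn
  simpa using hn

/-- Each coordinate of the walk fluctuates by at most `O(√(n log n))` around its drift. -/
lemma ae_eventually_abs_coord_le (hRW : IsRWI P a h p α q S F) (k : Fin 3) :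
    ∃ D, 0 ≤ D ∧ ∀ᵐ ω ∂P, ∀ᶠ n : ℕ in atTop,
      |S n ω k - n * muI a h p α q k| ≤ D * √(n * Real.log n) := by
  set d := centred a h p α q k with hd
  set c := 1 + ∑ i, ∑ s, |d i s| with hc
  have hc0 : 0 < c := by positivity
  have hdc : ∀ i s, |d i s| ≤ c := fun i s => by
    have h1 : |d i s| ≤ ∑ s, |d i s| :=
      Finset.single_le_sum (f := fun s => |d i s|) (fun _ _ => abs_nonneg _) (Finset.mem_univ s)
    have h2 : ∑ s, |d i s| ≤ ∑ i, ∑ s, |d i s| :=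
      Finset.single_le_sum (f := fun i => ∑ s, |d i s|)
        (fun _ _ => Finset.sum_nonneg fun _ _ => abs_nonneg _) (Finset.mem_univ i)
    linarith
  have hd0 := sum_weight_mul_centred (a := a) (h := h) (α := α) hRW.hq hRW.hqsum k
  have hstep : ∀ i, ∀ x ∈ V a h i, ∀ s, corrected a h p q k (x + step a h i s)
      = corrected a h p q k x + muI a h p α q k + d i s :=
    fun i x hx s => corrected_add_step hRW.ha k hx s
  have hm := measurable_corrected a h p q k
  have hz := corrected_zero hRW.ha h p q k
  have up := ae_eventually_lt hRW hm hz hc0 hdc hd0 hstep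
  have low := ae_eventually_lt hRW (G := fun x => -corrected a h p q k x) hm.neg (by simp [hz])
    (m := -muI a h p α q k) (d := fun i s => -d i s) hc0 (by simpa using hdc)
    (by simpa [d] using hd0) (fun i x hx s => by rw [hstep i x hx s]; ring)
  refine ⟨2 * c + 2 * |corr a p q k|, by positivity, ?_⟩
  filter_upwards [up, low] with ω h1 h2
  filter_upwards [h1, h2, eventually_ge_atTop 3] with n g1 g2 hn
  have hn3 : (3 : ℝ) ≤ n := by exact_mod_cast hn
  have hlog : 1 ≤ Real.log n := by
    rw [Real.le_log_iff_exp_le (by linarith)]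
    linarith [Real.exp_one_lt_d9]
  have hL : 1 ≤ √(n * Real.log n) := by
    rw [Real.one_le_sqrt]; nlinarith
  have hcorr : |corr a p q k * (sign a h (S n ω) - 1)|
      ≤ 2 * |corr a p q k| * √(n * Real.log n) := by
    rw [abs_mul]
    have : |sign a h (S n ω) - 1| ≤ 2 := by
      have := abs_le.mp (abs_sign_le a h (S n ω))
      rw [abs_le]; constructor <;> linarith
    nlinarith [abs_nonneg (corr a p q k), mul_le_mul_of_nonneg_left this (abs_nonneg (corr a p q k)),
      mul_le_mul_of_nonneg_left hL (abs_nonneg (corr a p q k))]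
  obtain ⟨b1, b2⟩ := abs_le.mp hcorr
  simp only [corrected] at g1 g2
  rw [abs_le]
  constructor <;> linarith

end

end RWI

theorem rwi_slln_rate {Ω : Type} [MeasurableSpace Ω] (P : Measure Ω)
    (a h p α : ℝ) (q : Fin 2 → Fin 3 → ℝ)
    (S : ℕ → Ω → RWI.E) (F : ℕ → MeasurableSpace Ω)
    (hRW : RWI.IsRWI P a h p α q S F) :
    ∀ᵐ ω ∂P, ∃ C > (0 : ℝ), ∃ N : ℕ, ∀ n ≥ N,
      ‖(n : ℝ)⁻¹ • S n ω - RWI.muI a h p α q‖ ^ 2 ≤ C * Real.log n / n := by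
  choose D hD0 hD using RWI.ae_eventually_abs_coord_le hRW
  have hall := ae_all_iff.mpr hD
  filter_upwards [hall] with ω hω
  refine ⟨1 + ∑ k, D k ^ 2, by positivity, ?_⟩
  obtain ⟨N, hN⟩ := eventually_atTop.mp ((eventually_all.mpr hω).and (eventually_ge_atTop 1))
  refine ⟨N, fun n hn => ?_⟩
  obtain ⟨hb, hn1⟩ := hN n hn
  have hn0 : (0 : ℝ) < n := by exact_mod_cast hn1
  have hlog : 0 ≤ Real.log n := Real.log_natCast_nonneg n
  have hcoord : ∀ k, ((n : ℝ)⁻¹ * S n ω k - RWI.muI a h p α q k) ^ 2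
      ≤ D k ^ 2 * (Real.log n / n) := by
    intro k
    have h1 : (S n ω k - n * RWI.muI a h p α q k) ^ 2 ≤ D k ^ 2 * (n * Real.log n) := by
      rw [← Real.sq_sqrt (show 0 ≤ n * Real.log n by positivity), ← mul_pow, ← sq_abs]
      exact pow_le_pow_left₀ (abs_nonneg _) (hb k) 2
    calc ((n : ℝ)⁻¹ * S n ω k - RWI.muI a h p α q k) ^ 2
        = (S n ω k - n * RWI.muI a h p α q k) ^ 2 / n ^ 2 := by field_simp
      _ ≤ D k ^ 2 * (n * Real.log n) / n ^ 2 := by gcongr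
      _ = D k ^ 2 * (Real.log n / n) := by field_simp
  have hnorm : ‖(n : ℝ)⁻¹ • S n ω - RWI.muI a h p α q‖ ^ 2
      = ∑ k, ((n : ℝ)⁻¹ * S n ω k - RWI.muI a h p α q k) ^ 2 := by
    simp [EuclideanSpace.norm_sq_eq]
  rw [hnorm, mul_div_assoc, add_mul, one_mul, Finset.sum_mul]
  have : 0 ≤ Real.log n / n := by positivity
  linarith [Finset.sum_le_sum fun k (_ : k ∈ Finset.univ) => hcoord k]
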